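/- Let p ≥ 2 be a real number and let x ∈ ℝⁿ. Then for every index j ∈ [n], |x_j|^{p−2} · ‖x‖₂² ≤ n^{1−2/p} · ‖x‖_p^p. -/

import Mathlib

open Real

/-- Comparison of the squared Euclidean norm with the `p`-norm, for `p ≥ 2`. -/
theorem sum_sq_le_card_rpow_mul_sum_abs_rpow {ι : Type*} (s : Finset ι) {p : ℝ} (hp : 2 ≤ p)
    (x : ι → ℝ) :
    ∑ i ∈ s, x i ^ 2 ≤ (s.card : ℝ) ^ (1 - 2 / p) * (∑ i ∈ s, |x i| ^ p) ^ (2 / p) := by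
  have hp0 : 0 < p := by linarith
  have hsum : 0 ≤ ∑ i ∈ s, x i ^ 2 := Finset.sum_nonneg fun i _ => sq_nonneg _
  have hpow (i : ι) : (x i ^ 2) ^ (p / 2) = |x i| ^ p := by
    rw [← sq_abs, ← Real.rpow_natCast, ← Real.rpow_mul (abs_nonneg _)]
    congr 1
    push_cast
    ring
  have h := Real.rpow_sum_le_const_mul_sum_rpow_of_nonneg s (p := p / 2) (by linarith)
    (fun i _ => sq_nonneg (x i))
  simp only [hpow] at h
  calc ∑ i ∈ s, x i ^ 2 = ((∑ i ∈ s, x i ^ 2) ^ (p / 2)) ^ (2 / p) := by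
        rw [← Real.rpow_mul hsum, show p / 2 * (2 / p) = 1 by field_simp, Real.rpow_one]
    _ ≤ ((s.card : ℝ) ^ (p / 2 - 1) * ∑ i ∈ s, |x i| ^ p) ^ (2 / p) := by gcongr
    _ = _ := by
        rw [Real.mul_rpow (by positivity) (by positivity), ← Real.rpow_mul (by positivity)]
        congr 2
        field_simp

/-- For `p ≥ 2` and `x ∈ ℝⁿ`, each index `j` satisfies
`|x_j|^{p−2} ‖x‖₂² ≤ n^{1−2/p} ‖x‖_p^p`. -/
theorem stmt15 {n : ℕ} (p : ℝ) (hp : 2 ≤ p) (x : Fin n → ℝ) (j : Fin n) :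
    |x j| ^ (p - 2) * ∑ i, (x i) ^ 2 ≤ (n : ℝ) ^ (1 - 2 / p) * ∑ i, |x i| ^ p := by
  have hp0 : 0 < p := by linarith
  have hexp : 0 ≤ 1 - 2 / p := by
    rw [sub_nonneg, div_le_one hp0]
    exact hp
  have hS : 0 ≤ ∑ i, |x i| ^ p := by positivity
  have hj : |x j| ^ (p - 2) ≤ (∑ i, |x i| ^ p) ^ (1 - 2 / p) := by
    have hle : |x j| ^ p ≤ ∑ i, |x i| ^ p :=
      Finset.single_le_sum (f := fun i => |x i| ^ p) (fun i _ => by positivity)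
        (Finset.mem_univ j)
    calc |x j| ^ (p - 2) = (|x j| ^ p) ^ (1 - 2 / p) := by
          rw [← Real.rpow_mul (abs_nonneg _)]
          congr 1
          field_simp
      _ ≤ _ := by gcongr
  have h2 := sum_sq_le_card_rpow_mul_sum_abs_rpow Finset.univ hp x
  rw [Finset.card_univ, Fintype.card_fin] at h2
  calc |x j| ^ (p - 2) * ∑ i, (x i) ^ 2
      ≤ (∑ i, |x i| ^ p) ^ (1 - 2 / p) *
          ((n : ℝ) ^ (1 - 2 / p) * (∑ i, |x i| ^ p) ^ (2 / p)) := by gcongr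
    _ = (n : ℝ) ^ (1 - 2 / p) *
          ((∑ i, |x i| ^ p) ^ (1 - 2 / p) * (∑ i, |x i| ^ p) ^ (2 / p)) := by ring
    _ = _ := by
        rw [← Real.rpow_add_of_nonneg hS hexp (by positivity), sub_add_cancel, Real.rpow_one]
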